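/- For every real s > 1 and every positive integer n, ζ({s}^n) = P_n(ζ(s), −ζ(2s), ζ(3s), …, (−1)^{n+1} ζ(ns)) and ζ⋆({s}^n) = P_n(ζ(s), ζ(2s), …, ζ(ns)), where ζ denotes the Riemann zeta function and P_n is the n-th modified Bell polynomial. -/

import Mathlib

open Real Finset

/-- Multiple zeta value with real exponents `a i`, summed over
`1 ≤ k₁ < k₂ < ⋯ < k_r`. -/
noncomputable def mzv {r : ℕ} (a : Fin r → ℝ) : ℝ :=
  ∑' f : {f : Fin r → ℕ // (∀ i, 1 ≤ f i) ∧ StrictMono f},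
    ∏ i, ((f.1 i : ℝ)) ^ (-(a i))

/-- Multiple zeta star value with real exponents `a i`, summed over
`1 ≤ k₁ ≤ k₂ ≤ ⋯ ≤ k_r`. -/
noncomputable def mzsv {r : ℕ} (a : Fin r → ℝ) : ℝ :=
  ∑' f : {f : Fin r → ℕ // (∀ i, 1 ≤ f i) ∧ Monotone f},
    ∏ i, ((f.1 i : ℝ)) ^ (-(a i))


/-- The Riemann zeta function at a real `s > 1`, given by its Dirichlet series. -/
noncomputable def realZeta (s : ℝ) : ℝ := ∑' k : ℕ, ((k : ℝ) + 1) ^ (-s)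

/-- The `n`-th modified Bell polynomial
`P_n(x₁,…,x_n) = Σ_{k₁+2k₂+⋯+nk_n=n} (1/(k₁!⋯k_n!)) (x₁/1)^{k₁}⋯(x_n/n)^{k_n}`. -/
noncomputable def modBell (n : ℕ) (x : ℕ → ℝ) : ℝ :=
  ∑ a ∈ (Fintype.piFinset (fun _ : Fin n => Finset.range (n + 1))).filter
      (fun a => ∑ i : Fin n, ((i : ℕ) + 1) * a i = n),
    ∏ i : Fin n, (x ((i : ℕ) + 1) / ((i : ℕ) + 1)) ^ (a i) / (Nat.factorial (a i))

section TruncatedSums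

/-- The strictly increasing `n`-tuples of natural numbers below `N`. -/
noncomputable def strictTuples (n N : ℕ) : Finset (Fin n → ℕ) :=
  (Fintype.piFinset fun _ : Fin n => range N).filter StrictMono

/-- The weakly increasing `n`-tuples of natural numbers below `N`. -/
noncomputable def weakTuples (n N : ℕ) : Finset (Fin n → ℕ) :=
  (Fintype.piFinset fun _ : Fin n => range N).filter Monotone

lemma mem_strictTuples {n N : ℕ} {f : Fin n → ℕ} :
    f ∈ strictTuples n N ↔ (∀ i, f i < N) ∧ StrictMono f := by
  simp [strictTuples]

lemma mem_weakTuples {n N : ℕ} {f : Fin n → ℕ} :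
    f ∈ weakTuples n N ↔ (∀ i, f i < N) ∧ Monotone f := by
  simp [weakTuples]

lemma strictMono_snoc_iff {n : ℕ} {f : Fin n → ℕ} {m : ℕ} :
    StrictMono (Fin.snoc f m : Fin (n + 1) → ℕ) ↔ (∀ i, f i < m) ∧ StrictMono f := by
  constructor
  · intro h
    refine ⟨fun i => by simpa using h (Fin.castSucc_lt_last i), fun i j hij => ?_⟩
    simpa using h (Fin.castSucc_lt_castSucc_iff.2 hij)
  · rintro ⟨h₁, h₂⟩ i j hij
    induction j using Fin.lastCases with
    | last =>
      induction i using Fin.lastCases with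
      | last => exact absurd hij (lt_irrefl _)
      | cast i => simpa using h₁ i
    | cast j =>
      induction i using Fin.lastCases with
      | last => exact absurd hij (Fin.castSucc_lt_last j).not_gt
      | cast i => simpa using h₂ (Fin.castSucc_lt_castSucc_iff.1 hij)

lemma monotone_snoc_iff {n : ℕ} {f : Fin n → ℕ} {m : ℕ} :
    Monotone (Fin.snoc f m : Fin (n + 1) → ℕ) ↔ (∀ i, f i ≤ m) ∧ Monotone f := by
  constructor
  · intro h
    refine ⟨fun i => by simpa using h (Fin.castSucc_lt_last i).le, fun i j hij => ?_⟩
    simpa using h (Fin.castSucc_le_castSucc_iff.2 hij)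
  · rintro ⟨h₁, h₂⟩ i j hij
    induction j using Fin.lastCases with
    | last =>
      induction i using Fin.lastCases with
      | last => exact le_rfl
      | cast i => simpa using h₁ i
    | cast j =>
      induction i using Fin.lastCases with
      | last => exact absurd hij (Fin.castSucc_lt_last j).not_ge
      | cast i => simpa using h₂ (Fin.castSucc_le_castSucc_iff.1 hij)

/-- Truncated multiple sum over strictly increasing tuples. -/
noncomputable def strictSum (g : ℕ → ℝ) (n N : ℕ) : ℝ :=
  ∑ f ∈ strictTuples n N, ∏ i, g (f i)

/-- Truncated multiple sum over weakly increasing tuples. -/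
noncomputable def weakSum (g : ℕ → ℝ) (n N : ℕ) : ℝ :=
  ∑ f ∈ weakTuples n N, ∏ i, g (f i)

lemma strictSum_zero_left (g : ℕ → ℝ) (N : ℕ) : strictSum g 0 N = 1 := by
  have : strictTuples 0 N = {Fin.elim0} := by
    ext f
    simp [mem_strictTuples, Subsingleton.strictMono, Subsingleton.elim f Fin.elim0]
  simp [strictSum, this]

lemma weakSum_zero_left (g : ℕ → ℝ) (N : ℕ) : weakSum g 0 N = 1 := by
  have : weakTuples 0 N = {Fin.elim0} := by
    ext f
    simp [mem_weakTuples, Subsingleton.monotone, Subsingleton.elim f Fin.elim0]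
  simp [weakSum, this]

lemma strictSum_succ_left (g : ℕ → ℝ) (n N : ℕ) :
    strictSum g (n + 1) N = ∑ m ∈ range N, strictSum g n m * g m := by
  simp only [strictSum, sum_mul]
  rw [sum_sigma']
  symm
  refine sum_nbij' (fun x => (Fin.snoc x.2 x.1 : Fin (n + 1) → ℕ))
    (fun f => ⟨f (Fin.last n), Fin.init f⟩) ?_ ?_ ?_ ?_ ?_
  · rintro ⟨m, f⟩ h
    simp only [mem_sigma, mem_range, mem_strictTuples] at h
    simp only [mem_strictTuples, strictMono_snoc_iff, Fin.forall_fin_succ', Fin.snoc_castSucc,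
      Fin.snoc_last]
    exact ⟨⟨fun i => (h.2.1 i).trans h.1, h.1⟩, h.2⟩
  · intro f h
    rw [mem_strictTuples, ← Fin.snoc_init_self f, strictMono_snoc_iff] at h
    simp only [mem_sigma, mem_range, mem_strictTuples]
    exact ⟨by simpa using h.1 (Fin.last n), h.2⟩
  · simp
  · simp
  · rintro ⟨m, f⟩ h
    simp [Fin.prod_univ_castSucc]

lemma weakSum_succ_left (g : ℕ → ℝ) (n N : ℕ) :
    weakSum g (n + 1) N = ∑ m ∈ range N, weakSum g n (m + 1) * g m := by
  simp only [weakSum, sum_mul]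
  rw [sum_sigma']
  symm
  refine sum_nbij' (fun x => (Fin.snoc x.2 x.1 : Fin (n + 1) → ℕ))
    (fun f => ⟨f (Fin.last n), Fin.init f⟩) ?_ ?_ ?_ ?_ ?_
  · rintro ⟨m, f⟩ h
    simp only [mem_sigma, mem_range, mem_weakTuples, Nat.lt_succ_iff] at h
    simp only [mem_weakTuples, monotone_snoc_iff, Fin.forall_fin_succ', Fin.snoc_castSucc,
      Fin.snoc_last]
    exact ⟨⟨fun i => (h.2.1 i).trans_lt h.1, h.1⟩, h.2⟩
  · intro f h
    rw [mem_weakTuples, ← Fin.snoc_init_self f, monotone_snoc_iff] at h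
    simp only [mem_sigma, mem_range, mem_weakTuples, Nat.lt_succ_iff]
    exact ⟨by simpa using h.1 (Fin.last n), h.2⟩
  · simp
  · simp
  · rintro ⟨m, f⟩ h
    simp [Fin.prod_univ_castSucc]

end TruncatedSums

section GeneratingFunctions

open PowerSeries

lemma strictSum_zero_right (g : ℕ → ℝ) :
    PowerSeries.mk (fun n => strictSum g n 0) = 1 := by
  ext n
  cases n <;> simp [strictSum_zero_left, strictSum_succ_left, coeff_one]

lemma weakSum_zero_right (g : ℕ → ℝ) :
    PowerSeries.mk (fun n => weakSum g n 0) = 1 := by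
  ext n
  cases n <;> simp [weakSum_zero_left, weakSum_succ_left, coeff_one]

lemma strictSum_genFun_succ (g : ℕ → ℝ) (N : ℕ) :
    PowerSeries.mk (fun n => strictSum g n (N + 1)) =
      (1 + C (g N) * X) * PowerSeries.mk (fun n => strictSum g n N) := by
  ext n
  cases n with
  | zero => simp [strictSum_zero_left, add_mul, mul_assoc]
  | succ n =>
    simp only [add_mul, one_mul, mul_assoc, map_add, coeff_mk, coeff_C_mul, coeff_succ_X_mul]
    rw [strictSum_succ_left, sum_range_succ, ← strictSum_succ_left]
    ring

lemma weakSum_genFun_succ (g : ℕ → ℝ) (N : ℕ) :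
    (1 - C (g N) * X) * PowerSeries.mk (fun n => weakSum g n (N + 1)) =
      PowerSeries.mk (fun n => weakSum g n N) := by
  ext n
  cases n with
  | zero => simp [weakSum_zero_left, sub_mul, mul_assoc]
  | succ n =>
    simp only [sub_mul, one_mul, mul_assoc, map_sub, coeff_mk, coeff_C_mul, coeff_succ_X_mul]
    rw [weakSum_succ_left, sum_range_succ, ← weakSum_succ_left]
    ring

lemma derivative_strictSum_genFun (g : ℕ → ℝ) (N : ℕ) :
    d⁄dX ℝ (PowerSeries.mk fun n => strictSum g n N) =
      PowerSeries.mk (fun k => (-1) ^ k * ∑ m ∈ range N, g m ^ (k + 1)) *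
        PowerSeries.mk (fun n => strictSum g n N) := by
  induction N with
  | zero =>
    rw [strictSum_zero_right]
    ext n
    simp
  | succ N ih =>
    have hℓ : PowerSeries.mk (fun k => (-1) ^ k * g N ^ (k + 1)) * (1 + C (g N) * X) =
        C (g N) := by
      ext n
      cases n with
      | zero => simp [mul_add, ← mul_assoc]
      | succ n =>
        simp only [mul_add, mul_one, ← mul_assoc, map_add, coeff_mk, coeff_succ_mul_X,
          coeff_mul_C, coeff_C]
        simp
        ring
    have hL : PowerSeries.mk (fun k => (-1) ^ k * ∑ m ∈ range (N + 1), g m ^ (k + 1)) =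
        PowerSeries.mk (fun k => (-1) ^ k * ∑ m ∈ range N, g m ^ (k + 1)) +
          PowerSeries.mk (fun k => (-1) ^ k * g N ^ (k + 1)) := by
      ext k
      simp [sum_range_succ, mul_add]
    rw [strictSum_genFun_succ, hL, Derivation.leibniz, ih]
    simp only [map_add, derivative_one, Derivation.leibniz, derivative_C, derivative_X,
      smul_eq_mul]
    linear_combination -(PowerSeries.mk fun n => strictSum g n N) * hℓ

lemma derivative_weakSum_genFun (g : ℕ → ℝ) (N : ℕ) :
    d⁄dX ℝ (PowerSeries.mk fun n => weakSum g n N) =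
      PowerSeries.mk (fun k => ∑ m ∈ range N, g m ^ (k + 1)) *
        PowerSeries.mk (fun n => weakSum g n N) := by
  induction N with
  | zero =>
    rw [weakSum_zero_right]
    ext n
    simp
  | succ N ih =>
    have hℓ : PowerSeries.mk (fun k => g N ^ (k + 1)) * (1 - C (g N) * X) = C (g N) := by
      ext n
      cases n with
      | zero => simp [mul_sub, ← mul_assoc]
      | succ n =>
        simp only [mul_sub, mul_one, ← mul_assoc, map_sub, coeff_mk, coeff_succ_mul_X,
          coeff_mul_C, coeff_C]
        simp
        ring
    have hL : PowerSeries.mk (fun k => ∑ m ∈ range (N + 1), g m ^ (k + 1)) =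
        PowerSeries.mk (fun k => ∑ m ∈ range N, g m ^ (k + 1)) +
          PowerSeries.mk (fun k => g N ^ (k + 1)) := by
      ext k
      simp [sum_range_succ]
    have hne : (1 - C (g N) * X : ℝ⟦X⟧) ≠ 0 := by
      intro h
      simpa using congrArg constantCoeff h
    have hrec := weakSum_genFun_succ g N
    have hD := congrArg (d⁄dX ℝ) hrec
    rw [ih, ← hrec] at hD
    simp only [map_sub, derivative_one, Derivation.leibniz, derivative_C, derivative_X,
      smul_eq_mul] at hD
    apply mul_left_cancel₀ hne
    rw [hL]
    linear_combination hD - (PowerSeries.mk fun n => weakSum g n (N + 1)) * hℓ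

/-- The power series `exp (c * X ^ k)` for `k ≠ 0`. -/
noncomputable def expMonomial (k : ℕ) (c : ℝ) : ℝ⟦X⟧ :=
  PowerSeries.mk fun l => if k ∣ l then c ^ (l / k) / (l / k).factorial else 0

lemma derivative_expMonomial (i : ℕ) (x : ℝ) :
    d⁄dX ℝ (expMonomial (i + 1) (x / (i + 1))) =
      C x * X ^ i * expMonomial (i + 1) (x / (i + 1)) := by
  ext l
  rw [coeff_derivative, mul_assoc, coeff_C_mul, coeff_X_pow_mul']
  simp only [expMonomial, coeff_mk]
  by_cases h : i + 1 ∣ l + 1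
  · obtain ⟨j, hj⟩ := h
    obtain _ | j := j
    · omega
    have hl : l = (i + 1) * j + i := by
      rw [Nat.mul_succ] at hj
      omega
    have hle : i ≤ l := by omega
    have hsub : l - i = (i + 1) * j := by omega
    rw [hj, hsub, if_pos (Dvd.intro _ rfl), if_pos hle, if_pos (Dvd.intro _ rfl),
      Nat.mul_div_cancel_left _ i.succ_pos, Nat.mul_div_cancel_left _ i.succ_pos]
    have hl' : (l : ℝ) = (i + 1) * j + i := by exact_mod_cast hl
    have : (i : ℝ) + 1 ≠ 0 := by positivity
    have : (j : ℝ) + 1 ≠ 0 := by positivity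
    have : (j.factorial : ℝ) ≠ 0 := by positivity
    rw [hl', pow_succ, Nat.factorial_succ]
    push_cast
    field_simp
    ring
  · rw [if_neg h]
    by_cases hle : i ≤ l
    · rw [if_pos hle, if_neg, zero_mul, mul_zero]
      intro h'
      apply h
      have := Nat.dvd_add h' (dvd_refl (i + 1))
      rwa [show l - i + (i + 1) = l + 1 by omega] at this
    · rw [if_neg hle, zero_mul, mul_zero]

lemma derivative_prod_of_logDeriv {ι : Type*} (s : Finset ι) (F L : ι → ℝ⟦X⟧)
    (h : ∀ i ∈ s, d⁄dX ℝ (F i) = L i * F i) :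
    d⁄dX ℝ (∏ i ∈ s, F i) = (∑ i ∈ s, L i) * ∏ i ∈ s, F i := by
  classical
  induction s using Finset.induction with
  | empty => simp
  | insert a s ha ih =>
    rw [prod_insert ha, sum_insert ha, Derivation.leibniz,
      ih fun i hi => h i (mem_insert_of_mem hi), h a (mem_insert_self a s)]
    simp only [smul_eq_mul]
    ring

/-- Truncation of the generating series `exp (∑ x k / k * X ^ k)` of the modified Bell
polynomials to the variables `x 1, …, x n`. -/
noncomputable def bellSeries (n : ℕ) (x : ℕ → ℝ) : ℝ⟦X⟧ :=
  ∏ i : Fin n, expMonomial (i + 1) (x (i + 1) / ((i : ℕ) + 1))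

lemma derivative_bellSeries (n : ℕ) (x : ℕ → ℝ) :
    d⁄dX ℝ (bellSeries n x) = (∑ i : Fin n, C (x (i + 1)) * X ^ (i : ℕ)) * bellSeries n x :=
  derivative_prod_of_logDeriv _ _ _ fun _ _ => derivative_expMonomial _ _

lemma coeff_zero_bellSeries (n : ℕ) (x : ℕ → ℝ) : coeff 0 (bellSeries n x) = 1 := by
  rw [bellSeries, coeff_zero_eq_constantCoeff_apply, map_prod]
  refine prod_eq_one fun i _ => ?_
  rw [← coeff_zero_eq_constantCoeff_apply]
  simp [expMonomial]

lemma coeff_bellSeries_self (n : ℕ) (x : ℕ → ℝ) : coeff n (bellSeries n x) = modBell n x := by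
  rw [bellSeries, coeff_prod, modBell]
  symm
  refine sum_of_injOn (fun a => Finsupp.equivFunOnFinite.symm fun i => ((i : ℕ) + 1) * a i)
    ?_ ?_ ?_ ?_
  · intro a _ b _ hab
    have := Finsupp.equivFunOnFinite.symm.injective hab
    funext i
    exact Nat.eq_of_mul_eq_mul_left (Nat.succ_pos _) (congrFun this i)
  · intro a ha
    simp only [coe_filter, Set.mem_ofPred_eq] at ha
    simp [ha.2]
  · intro l hl hnot
    by_contra hne
    have hdvd : ∀ i : Fin n, (i : ℕ) + 1 ∣ l i := by
      intro i
      by_contra hi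
      exact hne (prod_eq_zero (mem_univ i) (by simp [expMonomial, hi]))
    choose a ha using hdvd
    apply hnot
    simp only [mem_finsuppAntidiag] at hl
    refine ⟨a, ?_, ?_⟩
    · simp only [coe_filter, Set.mem_ofPred_eq, Fintype.mem_piFinset, mem_range, Nat.lt_succ_iff]
      refine ⟨fun i => ?_, by simpa [← ha] using hl.1⟩
      calc a i ≤ l i := by rw [ha i]; exact Nat.le_mul_of_pos_left _ (Nat.succ_pos _)
        _ ≤ univ.sum l := single_le_sum (f := fun i => l i) (fun _ _ => Nat.zero_le _) (mem_univ i)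
        _ = n := hl.1
    · ext i
      simp [ha i]
  · intro a _
    refine prod_congr rfl fun i _ => ?_
    simp [expMonomial, Nat.mul_div_cancel_left _ (Nat.succ_pos (i : ℕ))]

/-- A power series with constant coefficient `1` and logarithmic derivative
`∑ x (k + 1) * X ^ k` has the modified Bell polynomials as coefficients. -/
lemma coeff_eq_modBell {F : ℝ⟦X⟧} {x : ℕ → ℝ} (h0 : coeff 0 F = 1)
    (hD : d⁄dX ℝ F = PowerSeries.mk (fun k => x (k + 1)) * F) (n : ℕ) :
    coeff n F = modBell n x := by
  rw [← coeff_bellSeries_self]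
  suffices ∀ j ≤ n, coeff j F = coeff j (bellSeries n x) from this n le_rfl
  intro j
  induction j using Nat.strong_induction_on with
  | _ j ih =>
    intro hj
    obtain _ | j := j
    · rw [h0, coeff_zero_bellSeries]
    have h₁ := congrArg (coeff j) hD
    have h₂ := congrArg (coeff j) (derivative_bellSeries n x)
    rw [coeff_derivative, coeff_mul] at h₁ h₂
    have hne : (j : ℝ) + 1 ≠ 0 := by positivity
    apply mul_right_cancel₀ hne
    rw [h₁, h₂]
    refine sum_congr rfl fun p hp => ?_
    rw [HasAntidiagonal.mem_antidiagonal] at hp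
    rw [ih p.2 (by omega) (by omega)]
    congr 1
    have hp1 : p.1 < n := by omega
    simp only [coeff_mk, map_sum, coeff_C_mul, coeff_X_pow]
    rw [sum_eq_single (⟨p.1, hp1⟩ : Fin n)]
    · simp
    · intro i _ hi
      have : p.1 ≠ i := fun h => hi (Fin.ext h.symm)
      simp [this]
    · simp

lemma strictSum_eq_modBell (g : ℕ → ℝ) (n N : ℕ) :
    strictSum g n N =
      modBell n (fun k => (-1) ^ (k + 1) * ∑ m ∈ range N, g m ^ k) := by
  have h := coeff_eq_modBell (F := PowerSeries.mk fun n => strictSum g n N)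
    (x := fun k => (-1) ^ (k + 1) * ∑ m ∈ range N, g m ^ k)
    (by simp [strictSum_zero_left])
    (by rw [derivative_strictSum_genFun]; simp [pow_succ]) n
  simpa using h

lemma weakSum_eq_modBell (g : ℕ → ℝ) (n N : ℕ) :
    weakSum g n N = modBell n (fun k => ∑ m ∈ range N, g m ^ k) := by
  have h := coeff_eq_modBell (F := PowerSeries.mk fun n => weakSum g n N)
    (x := fun k => ∑ m ∈ range N, g m ^ k)
    (by simp [weakSum_zero_left]) (by rw [derivative_weakSum_genFun]) n
  simpa using h

end GeneratingFunctions

section Limits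

open Filter Topology

lemma tendsto_modBell {ι : Type*} {l : Filter ι} {u : ι → ℕ → ℝ} {x : ℕ → ℝ} (n : ℕ)
    (h : ∀ k, Tendsto (fun N => u N (k + 1)) l (𝓝 (x (k + 1)))) :
    Tendsto (fun N => modBell n (u N)) l (𝓝 (modBell n x)) :=
  tendsto_finsetSum _ fun _ _ => tendsto_finsetProd _ fun i _ =>
    (((h i).div_const _).pow _).div_const _

lemma tsum_tuples_eq_of_tendsto {n : ℕ} {g : ℕ → ℝ} (hg : ∀ m, 0 ≤ g m) (hg0 : g 0 = 0)
    (hs : Summable g) (p : (Fin n → ℕ) → Prop) [DecidablePred p] {c : ℝ}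
    (hlim : Tendsto (fun N => ∑ f ∈ (Fintype.piFinset fun _ : Fin n => range N).filter p,
      ∏ i, g (f i)) atTop (𝓝 c)) :
    ∑' f : {f : Fin n → ℕ // (∀ i, 1 ≤ f i) ∧ p f}, ∏ i, g (f.1 i) = c := by
  set G : (Fin n → ℕ) → ℝ := fun f => if p f then ∏ i, g (f i) else 0 with hG
  have hsub : ∑' f : {f : Fin n → ℕ // (∀ i, 1 ≤ f i) ∧ p f}, ∏ i, g (f.1 i) = ∑' f, G f := by
    refine (tsum_subtype {f : Fin n → ℕ | (∀ i, 1 ≤ f i) ∧ p f}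
      fun f => ∏ i, g (f i)).trans (tsum_congr fun f => ?_)
    by_cases hp : p f
    · by_cases h1 : ∀ i, 1 ≤ f i
      · simp [hG, Set.indicator, hp, h1]
      · rw [Set.indicator_of_notMem (fun h => h1 h.1)]
        push Not at h1
        obtain ⟨i, hi⟩ := h1
        have : g (f i) = 0 := by rw [Nat.lt_one_iff.1 hi, hg0]
        simp only [hG, if_pos hp]
        exact (prod_eq_zero (mem_univ i) this).symm
    · simp [hG, Set.indicator, hp]
  have hbox : Tendsto (fun N => Fintype.piFinset fun _ : Fin n => range N) atTop atTop := by
    refine tendsto_atTop_finset_of_monotone ?_ fun f => ⟨univ.sup f + 1, ?_⟩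
    · exact fun a b hab => Fintype.piFinset_subset _ _ fun _ => range_mono hab
    · simp only [Fintype.mem_piFinset, mem_range, Nat.lt_succ_iff]
      exact fun i => le_sup (mem_univ i)
  have hGnn : ∀ f : Fin n → ℕ, 0 ≤ ∏ i, g (f i) := fun f => prod_nonneg fun i _ => hg _
  have hGsum : Summable G := by
    have hall : Summable fun f : Fin n → ℕ => ∏ i, g (f i) := by
      refine summable_of_sum_le (c := (∑' m, g m) ^ n) hGnn fun u => ?_
      obtain ⟨N, hN⟩ := (hbox.eventually (eventually_ge_atTop u)).exists
      calc ∑ f ∈ u, ∏ i, g (f i)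
          ≤ ∑ f ∈ Fintype.piFinset fun _ : Fin n => range N, ∏ i, g (f i) :=
            sum_le_sum_of_subset_of_nonneg hN fun f _ _ => hGnn f
        _ = (∑ m ∈ range N, g m) ^ n := by
            rw [← prod_univ_sum (fun _ : Fin n => range N) fun _ m => g m]
            simp
        _ ≤ (∑' m, g m) ^ n :=
            pow_le_pow_left₀ (sum_nonneg fun m _ => hg m)
              (hs.sum_le_tsum _ fun m _ => hg m) n
    refine Summable.of_nonneg_of_le (fun f => ?_) (fun f => ?_) hall
    · simp only [hG]
      split_ifs
      exacts [hGnn f, le_rfl]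
    · simp only [hG]
      split_ifs
      exacts [le_rfl, hGnn f]
  rw [hsub]
  refine tendsto_nhds_unique (hGsum.hasSum.comp hbox) ?_
  simpa only [Function.comp_def, hG, sum_filter] using hlim

lemma tendsto_sum_range_rpow_pow {s : ℝ} (hs : 1 < s) (k : ℕ) :
    Tendsto (fun N => ∑ m ∈ range N, ((m : ℝ) ^ (-s)) ^ (k + 1)) atTop
      (𝓝 (realZeta (((k + 1 : ℕ) : ℝ) * s))) := by
  have hk : 1 < ((k + 1 : ℕ) : ℝ) * s := by
    have : (1 : ℝ) ≤ ((k + 1 : ℕ) : ℝ) := by exact_mod_cast Nat.succ_pos k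
    nlinarith
  have hpow : ∀ m : ℕ, ((m : ℝ) ^ (-s)) ^ (k + 1) = (m : ℝ) ^ (-(((k + 1 : ℕ) : ℝ) * s)) := by
    intro m
    rw [← Real.rpow_mul_natCast m.cast_nonneg]
    congr 1
    ring
  have hsum : Summable fun m : ℕ => (m : ℝ) ^ (-(((k + 1 : ℕ) : ℝ) * s)) :=
    Real.summable_nat_rpow.2 (by linarith)
  have hz : realZeta (((k + 1 : ℕ) : ℝ) * s) =
      ∑' m : ℕ, (m : ℝ) ^ (-(((k + 1 : ℕ) : ℝ) * s)) := by
    rw [hsum.tsum_eq_zero_add, Nat.cast_zero, Real.zero_rpow (by linarith), zero_add, realZeta]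
    simp
  simp only [hpow]
  rw [hz]
  exact hsum.hasSum.tendsto_sum_nat

end Limits

/-- For real `s > 1`: `ζ({s}^n) = P_n(ζ(s), -ζ(2s), …, (-1)^{n+1} ζ(ns))` and
`ζ⋆({s}^n) = P_n(ζ(s), ζ(2s), …, ζ(ns))`. -/
theorem zeta_rep_modBell (s : ℝ) (hs : 1 < s) (n : ℕ) (hn : 1 ≤ n) :
    mzv (fun _ : Fin n => s) =
      modBell n (fun k => (-1 : ℝ) ^ (k + 1) * realZeta (k * s)) ∧
    mzsv (fun _ : Fin n => s) = modBell n (fun k => realZeta (k * s)) := by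
  have hg : ∀ m : ℕ, 0 ≤ (m : ℝ) ^ (-s) := fun m => Real.rpow_nonneg m.cast_nonneg _
  have hg0 : ((0 : ℕ) : ℝ) ^ (-s) = 0 := by
    rw [Nat.cast_zero, Real.zero_rpow (by linarith)]
  have hsum : Summable fun m : ℕ => (m : ℝ) ^ (-s) := Real.summable_nat_rpow.2 (by linarith)
  constructor
  · refine tsum_tuples_eq_of_tendsto hg hg0 hsum StrictMono ?_
    have h := tendsto_modBell
      (u := fun N k => (-1) ^ (k + 1) * ∑ m ∈ range N, ((m : ℝ) ^ (-s)) ^ k)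
      (x := fun k => (-1) ^ (k + 1) * realZeta (k * s)) n
      fun k => (tendsto_sum_range_rpow_pow hs k).const_mul _
    exact h.congr fun N => (strictSum_eq_modBell (fun m : ℕ => (m : ℝ) ^ (-s)) n N).symm
  · refine tsum_tuples_eq_of_tendsto hg hg0 hsum Monotone ?_
    have h := tendsto_modBell
      (u := fun N k => ∑ m ∈ range N, ((m : ℝ) ^ (-s)) ^ k)
      (x := fun k => realZeta (k * s)) n fun k => tendsto_sum_range_rpow_pow hs k
    exact h.congr fun N => (weakSum_eq_modBell (fun m : ℕ => (m : ℝ) ^ (-s)) n N).symm
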